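/- arXiv:2401.15778 — 3 statements merged into one kernel-verified Lean document; each statement's English description precedes it below -/
import Mathlib

section
/- Fix real constants τ > 1, κ > 0 and C₀ > 0. There exists a constant C > 0, depending only on τ, κ and C₀, such that for every integer j ≥ 2 and every function γ : [0,1] × ℕ → ℝ satisfying |γ(t, r)| ≤ C₀(r + 1)^{−τ} for all t ∈ [0,1] and r ∈ ℕ, and λ_min(Γ_j(t)) ≥ κ for all t ∈ [0,1], one has sup_{t∈[0,1]} |ρ_j(t)| ≤ C((log j + 1)/j)^{τ−1}. -/
open MeasureTheory Matrix Finset in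
/-- Euclidean (ℓ²) norm on `Fin j → ℝ`. -/
noncomputable def euclNorm {j : ℕ} (v : Fin j → ℝ) : ℝ := Real.sqrt (∑ k, (v k) ^ 2)

open Matrix in
/-- `quadLB A κ` : the quadratic form of `A` is bounded below by `κ·|v|²`.
For a symmetric matrix this says exactly that the smallest eigenvalue is at least `κ`. -/
def quadLB {j : ℕ} (A : Matrix (Fin j) (Fin j) ℝ) (κ : ℝ) : Prop :=
  ∀ v : Fin j → ℝ, κ * (∑ k, (v k) ^ 2) ≤ v ⬝ᵥ (A *ᵥ v)

/-- ℓ²→ℓ² operator norm of a square real matrix. -/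
noncomputable def opNorm {j : ℕ} (A : Matrix (Fin j) (Fin j) ℝ) : ℝ :=
  ‖(Matrix.toEuclideanCLM (𝕜 := ℝ) A : EuclideanSpace ℝ (Fin j) →L[ℝ] EuclideanSpace ℝ (Fin j))‖

/-- `Γ_j(t)` built from a local autocovariance function `γ`:
its `(k,l)` entry (1-based) is `γ t |k-l|`. -/
def gammaMat (γ : ℝ → ℕ → ℝ) (t : ℝ) (j : ℕ) : Matrix (Fin j) (Fin j) ℝ :=
  Matrix.of fun k l : Fin j => γ t ((k.1 : ℤ) - (l.1 : ℤ)).natAbs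

/-- `ν_j(t)` built from a local autocovariance function `γ`: its `k`-th entry (1-based)
is `γ t k`. -/
def gammaVec (γ : ℝ → ℕ → ℝ) (t : ℝ) (j : ℕ) : Fin j → ℝ := fun k => γ t (k.1 + 1)

/-- Banded truncation of a matrix at bandwidth `b`: keeps the entries with `|k-l| ≤ b`
and sets all others to zero. -/
def bandTrunc {j : ℕ} (A : Matrix (Fin j) (Fin j) ℝ) (b : ℕ) : Matrix (Fin j) (Fin j) ℝ :=
  Matrix.of fun k l : Fin j => if ((k.1 : ℤ) - (l.1 : ℤ)).natAbs ≤ b then A k l else 0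

theorem rpow_neg_sub_one_telescope {s : ℝ} (hs : 0 < s) {r : ℕ} (hr : 1 ≤ r) :
    s * ((r : ℝ) + 1) ^ (-(s + 1)) ≤ (r : ℝ) ^ (-s) - ((r : ℝ) + 1) ^ (-s) := by
  have hr0 : (0 : ℝ) < r := by exact_mod_cast hr
  have hr1 : (0 : ℝ) < (r : ℝ) + 1 := by positivity
  have hlog : Real.log ((r : ℝ) / (r + 1)) ≤ (r : ℝ) / (r + 1) - 1 :=
    Real.log_le_sub_one_of_pos (by positivity)
  have hratio : 1 + s / ((r : ℝ) + 1) ≤ ((r : ℝ) / (r + 1)) ^ (-s) := by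
    rw [Real.rpow_def_of_pos (by positivity)]
    have hexp := Real.add_one_le_exp (Real.log ((r : ℝ) / (r + 1)) * -s)
    have heq : (r : ℝ) / (r + 1) - 1 = -(1 / ((r : ℝ) + 1)) := by field_simp; ring
    rw [heq] at hlog
    have : s / ((r : ℝ) + 1) = s * (1 / ((r : ℝ) + 1)) := by ring
    nlinarith
  have hsplit : (r : ℝ) ^ (-s) = ((r : ℝ) / (r + 1)) ^ (-s) * ((r : ℝ) + 1) ^ (-s) := by
    rw [← Real.mul_rpow (by positivity) hr1.le, div_mul_cancel₀ _ hr1.ne']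
  have hpow : ((r : ℝ) + 1) ^ (-(s + 1)) = ((r : ℝ) + 1) ^ (-s) / ((r : ℝ) + 1) := by
    rw [neg_add, ← sub_eq_add_neg, Real.rpow_sub_one hr1.ne']
  rw [hsplit, hpow]
  have := mul_le_mul_of_nonneg_right hratio (Real.rpow_nonneg hr1.le (-s))
  calc s * (((r : ℝ) + 1) ^ (-s) / ((r : ℝ) + 1))
      = (1 + s / ((r : ℝ) + 1)) * ((r : ℝ) + 1) ^ (-s) - ((r : ℝ) + 1) ^ (-s) := by ring
    _ ≤ _ := by linarith

theorem sum_Ico_rpow_neg_le {s : ℝ} (hs : 0 < s) {m : ℕ} (hm : 1 ≤ m) (n : ℕ) :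
    ∑ r ∈ Finset.Ico m n, ((r : ℝ) + 1) ^ (-(s + 1)) ≤ (m : ℝ) ^ (-s) / s := by
  rcases le_total n m with h | h
  · rw [Finset.Ico_eq_empty_of_le h, Finset.sum_empty]; positivity
  rw [le_div_iff₀ hs, mul_comm, Finset.mul_sum]
  calc ∑ r ∈ Finset.Ico m n, s * ((r : ℝ) + 1) ^ (-(s + 1))
      ≤ ∑ r ∈ Finset.Ico m n, (-((r + 1 : ℕ) : ℝ) ^ (-s) - -(r : ℝ) ^ (-s)) := by
        refine Finset.sum_le_sum fun r hr => ?_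
        have := rpow_neg_sub_one_telescope hs (hm.trans (Finset.mem_Ico.1 hr).1)
        push_cast
        linarith
    _ = -(n : ℝ) ^ (-s) - -(m : ℝ) ^ (-s) :=
        Finset.sum_Ico_sub (fun r : ℕ => -(r : ℝ) ^ (-s)) h
    _ ≤ (m : ℝ) ^ (-s) := by
        have : (0 : ℝ) ≤ (n : ℝ) ^ (-s) := by positivity
        linarith

theorem sum_range_rpow_neg_le {s : ℝ} (hs : 0 < s) (n : ℕ) :
    ∑ r ∈ Finset.range n, ((r : ℝ) + 1) ^ (-(s + 1)) ≤ 1 + 1 / s := by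
  rcases Nat.eq_zero_or_pos n with rfl | h
  · simp; positivity
  rw [Finset.range_eq_Ico, Finset.sum_eq_sum_Ico_succ_bot h]
  have := sum_Ico_rpow_neg_le hs le_rfl n
  simpa using this

theorem sum_range_ite_rpow_neg_le {s β : ℝ} (hs : 0 < s) (hβ : 0 < β) (n : ℕ) :
    ∑ r ∈ Finset.range n, (if β < (r : ℝ) then ((r : ℝ) + 1) ^ (-(s + 1)) else 0) ≤
      β ^ (-s) / s := by
  calc ∑ r ∈ Finset.range n, (if β < (r : ℝ) then ((r : ℝ) + 1) ^ (-(s + 1)) else 0)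
      = ∑ r ∈ (Finset.range n).filter (fun r : ℕ => β < (r : ℝ)),
          ((r : ℝ) + 1) ^ (-(s + 1)) := (Finset.sum_filter _ _).symm
    _ ≤ ∑ r ∈ Finset.Ico (⌊β⌋₊ + 1) n, ((r : ℝ) + 1) ^ (-(s + 1)) := by
        refine Finset.sum_le_sum_of_subset_of_nonneg (fun r hr => ?_) fun r _ _ => by positivity
        obtain ⟨hrn, hr⟩ := Finset.mem_filter.1 hr
        exact Finset.mem_Ico.2 ⟨(Nat.floor_lt hβ.le).2 hr, Finset.mem_range.1 hrn⟩
    _ ≤ ((⌊β⌋₊ + 1 : ℕ) : ℝ) ^ (-s) / s := sum_Ico_rpow_neg_le hs (by omega) n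
    _ ≤ β ^ (-s) / s := by
        refine div_le_div_of_nonneg_right ?_ hs.le
        refine Real.rpow_le_rpow_of_nonpos hβ ?_ (neg_nonpos.2 hs.le)
        push_cast
        exact (Nat.lt_floor_add_one β).le

theorem sum_natAbs_sub_le {j : ℕ} {f : ℕ → ℝ} (hf : ∀ r, 0 ≤ f r) (k : Fin j) :
    ∑ l : Fin j, f ((k.1 : ℤ) - (l.1 : ℤ)).natAbs ≤ 2 * ∑ r ∈ Finset.range j, f r := by
  rw [← Finset.sum_fiberwise_of_maps_to (t := Finset.range j)
    (g := fun l : Fin j => ((k.1 : ℤ) - (l.1 : ℤ)).natAbs)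
    (fun l _ => Finset.mem_range.2 (by have := k.2; have := l.2; omega)), Finset.mul_sum]
  refine Finset.sum_le_sum fun r _ => ?_
  have hcard : (Finset.univ.filter
      fun l : Fin j => ((k.1 : ℤ) - (l.1 : ℤ)).natAbs = r).card ≤ 2 := by
    rw [← Finset.card_map Fin.valEmbedding]
    refine (Finset.card_le_card (t := {k.1 - r, k.1 + r}) fun x hx => ?_).trans
      Finset.card_le_two
    obtain ⟨l, hl, rfl⟩ := Finset.mem_map.1 hx
    have := (Finset.mem_filter.1 hl).2
    simp only [Fin.valEmbedding_apply, Finset.mem_insert, Finset.mem_singleton]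
    omega
  calc _ = ∑ l ∈ Finset.univ.filter
          (fun l : Fin j => ((k.1 : ℤ) - (l.1 : ℤ)).natAbs = r), f r :=
        Finset.sum_congr rfl fun l hl => by rw [(Finset.mem_filter.1 hl).2]
    _ ≤ 2 * f r := by
        rw [Finset.sum_const, nsmul_eq_mul]
        exact mul_le_mul_of_nonneg_right (by exact_mod_cast hcard) (hf r)

theorem euclNorm_nonneg {j : ℕ} (v : Fin j → ℝ) : 0 ≤ euclNorm v := Real.sqrt_nonneg _

theorem sq_euclNorm {j : ℕ} (v : Fin j → ℝ) : euclNorm v ^ 2 = ∑ k, (v k) ^ 2 :=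
  Real.sq_sqrt (Finset.sum_nonneg fun _ _ => sq_nonneg _)

theorem abs_le_euclNorm {j : ℕ} (v : Fin j → ℝ) (k : Fin j) : |v k| ≤ euclNorm v := by
  refine abs_le_of_sq_le_sq' ?_ (euclNorm_nonneg v) |> abs_le.2
  rw [sq_euclNorm]
  exact Finset.single_le_sum (f := fun k => (v k) ^ 2) (fun _ _ => sq_nonneg _)
    (Finset.mem_univ k)

/-- Schur's test, for the bilinear form of a nonnegative symmetric kernel. -/
theorem schur_test {j : ℕ} {K : Fin j → Fin j → ℝ} {S : ℝ} (hK : ∀ k l, 0 ≤ K k l)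
    (hsymm : ∀ k l, K k l = K l k) (hS : 0 ≤ S) (hsum : ∀ k, ∑ l, K k l ≤ S)
    (x y : Fin j → ℝ) :
    ∑ k, ∑ l, K k l * (|x k| * |y l|) ≤ S * euclNorm x * euclNorm y := by
  have hx : ∀ x : Fin j → ℝ, ∑ k, ∑ l, K k l * x k ^ 2 ≤ S * euclNorm x ^ 2 := fun x => by
    rw [sq_euclNorm, Finset.mul_sum]
    refine Finset.sum_le_sum fun k _ => ?_
    rw [← Finset.sum_mul]
    exact mul_le_mul_of_nonneg_right (hsum k) (sq_nonneg _)
  have hy : ∑ k, ∑ l, K k l * y l ^ 2 ≤ S * euclNorm y ^ 2 := by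
    rw [Finset.sum_comm]
    simpa only [hsymm] using hx y
  have hcs : (∑ k, ∑ l, K k l * (|x k| * |y l|)) ^ 2 ≤
      (∑ k, ∑ l, K k l * x k ^ 2) * ∑ k, ∑ l, K k l * y l ^ 2 := by
    simp only [← Fintype.sum_prod_type']
    refine Finset.sum_sq_le_sum_mul_sum_of_sq_le_mul _ (fun p _ => ?_) (fun p _ => ?_)
      fun p _ => ?_
    · exact mul_nonneg (hK _ _) (sq_nonneg _)
    · exact mul_nonneg (hK _ _) (sq_nonneg _)
    · rw [← sq_abs (x p.1), ← sq_abs (y p.2)]; exact le_of_eq (by ring)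
  have hprod := mul_le_mul (hx x) hy
    (Finset.sum_nonneg fun k _ => Finset.sum_nonneg fun l _ =>
      mul_nonneg (hK k l) (sq_nonneg _)) (by positivity)
  refine le_of_abs_le (abs_le_of_sq_le_sq (hcs.trans (hprod.trans_eq ?_)) ?_)
  · ring
  · exact mul_nonneg (mul_nonneg hS (euclNorm_nonneg x)) (euclNorm_nonneg y)

theorem det_ne_zero_of_quadLB {j : ℕ} {A : Matrix (Fin j) (Fin j) ℝ} {κ : ℝ} (hκ : 0 < κ)
    (hA : quadLB A κ) : A.det ≠ 0 := by
  intro hdet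
  obtain ⟨v, hv, hAv⟩ := Matrix.exists_mulVec_eq_zero_iff.2 hdet
  have h := hA v
  rw [hAv, dotProduct_zero, ← sq_euclNorm] at h
  refine hv (funext fun k => abs_nonpos_iff.1 ((abs_le_euclNorm v k).trans ?_))
  exact (pow_eq_zero_iff two_ne_zero).1
    (le_antisymm (nonpos_of_mul_nonpos_right h hκ) (sq_nonneg _)) |>.le

theorem sum_mul_le_euclNorm_mul {j : ℕ} (x y : Fin j → ℝ) :
    ∑ k, x k * y k ≤ euclNorm x * ∑ k, |y k| := by
  rw [Finset.mul_sum]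
  refine Finset.sum_le_sum fun k _ => (le_abs_self _).trans ?_
  rw [abs_mul]
  exact mul_le_mul_of_nonneg_right (abs_le_euclNorm x k) (abs_nonneg _)

open Matrix in
theorem euclNorm_le_of_mulVec_eq {j : ℕ} {A : Matrix (Fin j) (Fin j) ℝ} {κ M : ℝ}
    (hκ : 0 < κ) (hA : quadLB A κ) {φ ν : Fin j → ℝ} (hφ : A *ᵥ φ = ν)
    (hν : ∑ k, |ν k| ≤ M) : euclNorm φ ≤ M / κ := by
  have h := hA φ
  rw [hφ, ← sq_euclNorm] at h
  have h' : φ ⬝ᵥ ν ≤ euclNorm φ * M := (sum_mul_le_euclNorm_mul φ ν).trans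
    (mul_le_mul_of_nonneg_left hν (euclNorm_nonneg φ))
  rw [le_div_iff₀ hκ]
  rcases (euclNorm_nonneg φ).eq_or_lt with h0 | h0
  · rw [← h0, zero_mul]
    exact (Finset.sum_nonneg fun _ _ => abs_nonneg _).trans hν
  · nlinarith

open Matrix in
/-- Weighted energy estimate of Combes–Thomas type: if multiplying by the weight `w` perturbs
`A` by a near part of Schur norm at most `κ / 2` and a far part of Schur norm at most `T`, then
the weighted solution of `A φ = ν` is bounded. -/
theorem weighted_euclNorm_le {j : ℕ} {A : Matrix (Fin j) (Fin j) ℝ} {κ T P J : ℝ}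
    (hκ : 0 < κ) (hA : quadLB A κ) {φ ν w : Fin j → ℝ} (hφ : A *ᵥ φ = ν)
    (hJ : 0 ≤ J) (hT : 0 ≤ T) {N R : Fin j → Fin j → ℝ}
    (hN : ∀ k l, 0 ≤ N k l) (hNs : ∀ k l, N k l = N l k) (hNsum : ∀ k, ∑ l, N k l ≤ κ / 2)
    (hR : ∀ k l, 0 ≤ R k l) (hRs : ∀ k l, R k l = R l k) (hRsum : ∀ k, ∑ l, R k l ≤ T)
    (hpert : ∀ k l, |A k l * (φ l * (w l - w k))| ≤
      N k l * |w l * φ l| + J * (R k l * |φ l|))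
    (hν : ∑ k, |w k * ν k| ≤ P) :
    euclNorm (fun k => w k * φ k) ≤ 2 / κ * (P + J * T * euclNorm φ) := by
  set v : Fin j → ℝ := fun k => w k * φ k with hv
  have hV := euclNorm_nonneg v
  have hquad : v ⬝ᵥ (A *ᵥ v) =
      ∑ k, v k * (w k * ν k) + ∑ k, ∑ l, v k * (A k l * (φ l * (w l - w k))) := by
    rw [← Finset.sum_add_distrib]
    refine Finset.sum_congr rfl fun k _ => ?_
    rw [← hφ, ← Finset.mul_sum, ← mul_add]
    congr 1
    simp only [Matrix.mulVec, dotProduct, Finset.mul_sum, hv]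
    rw [← Finset.sum_add_distrib]
    exact Finset.sum_congr rfl fun l _ => by ring
  have hbil : ∑ k, ∑ l, v k * (A k l * (φ l * (w l - w k))) ≤
      ∑ k, ∑ l, N k l * (|v k| * |v l|) + J * ∑ k, ∑ l, R k l * (|v k| * |φ l|) := by
    rw [Finset.mul_sum, ← Finset.sum_add_distrib]
    refine Finset.sum_le_sum fun k _ => ?_
    rw [Finset.mul_sum, ← Finset.sum_add_distrib]
    refine Finset.sum_le_sum fun l _ => (le_abs_self _).trans ?_
    rw [abs_mul]
    refine (mul_le_mul_of_nonneg_left (hpert k l) (abs_nonneg _)).trans_eq ?_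
    simp only [hv]
    ring
  have hnear := schur_test hN hNs (by positivity) hNsum v v
  have hfar := mul_le_mul_of_nonneg_left (schur_test hR hRs hT hRsum v φ) hJ
  have hrhs := (sum_mul_le_euclNorm_mul v fun k => w k * ν k).trans
    (mul_le_mul_of_nonneg_left hν hV)
  have hmain := hA v
  rw [hquad, ← sq_euclNorm] at hmain
  have hP : 0 ≤ P := (Finset.sum_nonneg fun _ _ => abs_nonneg _).trans hν
  have hφ0 := euclNorm_nonneg φ
  rcases hV.eq_or_lt with h0 | h0
  · rw [← h0]; positivity
  · rw [div_mul_eq_mul_div, le_div_iff₀ hκ]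
    refine le_of_mul_le_mul_left ?_ h0
    nlinarith

theorem abs_one_sub_exp_le (x : ℝ) : |1 - Real.exp x| ≤ Real.exp |x| - 1 := by
  rcases le_total 0 x with h | h
  · rw [abs_of_nonneg h, abs_sub_comm, abs_of_nonneg]
    linarith [Real.one_le_exp h]
  · rw [abs_of_nonpos h, abs_of_nonneg (by linarith [Real.exp_le_one_iff.2 h])]
    have := Real.add_one_le_exp x
    have h1 : Real.exp x * Real.exp (-x) = 1 := by rw [← Real.exp_add]; simp
    nlinarith [sq_nonneg (Real.exp x - 1), Real.exp_pos x, Real.exp_pos (-x)]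

open Matrix in
/-- Bound on the last coordinate of the Yule–Walker solution by an exponential term, coming from
lags at most `β`, and a term measuring the summed covariances `T` at lags beyond `β`. -/
theorem abs_last_le_of_toeplitz {n : ℕ} {g : ℕ → ℝ} {κ M T L β : ℝ} (hκ : 0 < κ) (hL : 0 ≤ L)
    (hβ : 0 < β) {c : ℕ → ℝ} (hg : ∀ r, |g r| ≤ c r)
    (hM : 2 * ∑ r ∈ Finset.range (n + 2), c r ≤ M)
    (hT : 2 * ∑ r ∈ Finset.range (n + 2), (if β < (r : ℝ) then c r else 0) ≤ T)
    (hLM : (Real.exp L - 1) * M ≤ κ / 2) {A : Matrix (Fin (n + 1)) (Fin (n + 1)) ℝ}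
    (hAg : ∀ k l, A k l = g ((k.1 : ℤ) - (l.1 : ℤ)).natAbs) (hA : quadLB A κ)
    {φ : Fin (n + 1) → ℝ} (hφ : A *ᵥ φ = fun k => g (k.1 + 1)) :
    |φ (Fin.last n)| ≤
      2 / κ * (Real.exp (L - L / β * n) * M + T * (1 + M / κ)) := by
  have hc : ∀ r, 0 ≤ c r := fun r => (abs_nonneg _).trans (hg r)
  set d : ℕ → ℝ := fun r => if β < (r : ℝ) then c r else 0 with hd
  have hd0 : ∀ r, 0 ≤ d r := fun r => by simp only [hd]; split_ifs <;> simp [hc]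
  have hM0 : 0 ≤ M := (mul_nonneg two_pos.le (Finset.sum_nonneg fun r _ => hc r)).trans hM
  have hT0 : 0 ≤ T := (mul_nonneg two_pos.le (Finset.sum_nonneg fun r _ => hd0 r)).trans hT
  have hrow : ∀ (f : ℕ → ℝ), (∀ r, 0 ≤ f r) → ∀ k : Fin (n + 1),
      ∑ l : Fin (n + 1), f ((k.1 : ℤ) - (l.1 : ℤ)).natAbs ≤
        2 * ∑ r ∈ Finset.range (n + 2), f r := fun f hf k => by
    refine (sum_natAbs_sub_le hf k).trans ?_
    rw [Finset.sum_range_succ _ (n + 1)]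
    linarith [hf (n + 1)]
  have hshift : ∀ (f : ℕ → ℝ), (∀ r, 0 ≤ f r) →
      ∑ k : Fin (n + 1), f (k.1 + 1) ≤ 2 * ∑ r ∈ Finset.range (n + 2), f r := fun f hf => by
    rw [Fin.sum_univ_eq_sum_range (fun k => f (k + 1)), Finset.sum_range_succ' f (n + 1)]
    linarith [hf 0, Finset.sum_nonneg fun r (_ : r ∈ Finset.range (n + 1)) => hf (r + 1)]
  set a : ℝ := L / β with ha
  have ha0 : 0 ≤ a := by positivity
  have haβ : a * β = L := div_mul_cancel₀ _ hβ.ne'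
  set w : Fin (n + 1) → ℝ := fun k => Real.exp (a * k.1) with hw
  set J : ℝ := Real.exp (a * n) with hJ
  have hw0 : ∀ k, 0 < w k := fun k => Real.exp_pos _
  have hwJ : ∀ k, w k ≤ J := fun k => Real.exp_le_exp.2
    (mul_le_mul_of_nonneg_left (by exact_mod_cast Nat.lt_succ_iff.1 k.2) ha0)
  have hφM : euclNorm φ ≤ M / κ := euclNorm_le_of_mulVec_eq hκ hA hφ
    ((Finset.sum_le_sum fun k _ => hg (k.1 + 1)).trans ((hshift c hc).trans hM))
  have hcomm : ∀ k l : Fin (n + 1),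
      ((k.1 : ℤ) - (l.1 : ℤ)).natAbs = ((l.1 : ℤ) - (k.1 : ℤ)).natAbs := fun k l => by omega
  have hbound := weighted_euclNorm_le (w := w) (P := Real.exp L * M + J * T) hκ hA hφ
    (Real.exp_pos _).le hT0 (J := J)
    (N := fun k l => (Real.exp L - 1) * c ((k.1 : ℤ) - (l.1 : ℤ)).natAbs)
    (R := fun k l => d ((k.1 : ℤ) - (l.1 : ℤ)).natAbs)
    (fun k l => mul_nonneg (by linarith [Real.one_le_exp hL]) (hc _))
    (fun k l => by simp only [hcomm k l])
    (fun k => by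
      rw [← Finset.mul_sum]
      exact (mul_le_mul_of_nonneg_left ((hrow c hc k).trans hM)
        (by linarith [Real.one_le_exp hL])).trans hLM)
    (fun k l => hd0 _) (fun k l => by simp only [hcomm k l])
    (fun k => (hrow d hd0 k).trans hT)
    (fun k l => by
      rw [abs_mul, abs_mul, abs_mul, hAg, abs_of_pos (hw0 l)]
      set r := ((k.1 : ℤ) - (l.1 : ℤ)).natAbs with hr
      have hrabs : (r : ℝ) = |(k.1 : ℝ) - l.1| := by
        rw [hr, Nat.cast_natAbs]; push_cast; rfl
      by_cases hβr : β < (r : ℝ)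
      · have hdr : d r = c r := if_pos hβr
        have hwd : |w l - w k| ≤ J := abs_sub_le_iff.2
          ⟨by linarith [hw0 k, hwJ l], by linarith [hw0 l, hwJ k]⟩
        have h1 : |g r| * (|φ l| * |w l - w k|) ≤ c r * (|φ l| * J) := by
          gcongr
          · exact hc r
          · exact hg r
        have h2 : 0 ≤ (Real.exp L - 1) * c r * (w l * |φ l|) :=
          mul_nonneg (mul_nonneg (by linarith [Real.one_le_exp hL]) (hc r))
            (mul_nonneg (hw0 l).le (abs_nonneg _))
        rw [hdr]
        linarith
      · have hwd : |w l - w k| ≤ w l * (Real.exp L - 1) := by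
          have : w l - w k = w l * (1 - Real.exp (a * ((k.1 : ℝ) - l.1))) := by
            simp only [hw]
            rw [mul_sub, mul_one, ← Real.exp_add]
            congr 2
            ring
          rw [this, abs_mul, abs_of_pos (hw0 l)]
          refine mul_le_mul_of_nonneg_left ((abs_one_sub_exp_le _).trans ?_) (hw0 l).le
          rw [abs_mul, abs_of_nonneg ha0, ← hrabs, ← haβ]
          gcongr
          exact not_lt.1 hβr
        have h1 : |g r| * (|φ l| * |w l - w k|) ≤
            c r * (|φ l| * (w l * (Real.exp L - 1))) := by
          gcongr
          · exact hc r
          · exact hg r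
        have h2 : 0 ≤ J * (d r * |φ l|) :=
          mul_nonneg (Real.exp_pos _).le (mul_nonneg (hd0 r) (abs_nonneg _))
        linarith)
    (by
      calc ∑ k : Fin (n + 1), |w k * g (k.1 + 1)|
          ≤ ∑ k : Fin (n + 1), (Real.exp L * c (k.1 + 1) + J * d (k.1 + 1)) := by
            refine Finset.sum_le_sum fun k _ => ?_
            rw [abs_mul, abs_of_pos (hw0 k)]
            by_cases hβk : β < ((k.1 + 1 : ℕ) : ℝ)
            · have hdk : d (k.1 + 1) = c (k.1 + 1) := if_pos hβk
              rw [hdk]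
              have := mul_le_mul (hwJ k) (hg (k.1 + 1)) (abs_nonneg _) (Real.exp_pos _).le
              have := mul_nonneg (Real.exp_pos L).le (hc (k.1 + 1))
              linarith
            · have hwk : w k ≤ Real.exp L := by
                refine Real.exp_le_exp.2 ?_
                rw [← haβ]
                refine mul_le_mul_of_nonneg_left ?_ ha0
                have := not_lt.1 hβk
                push_cast at this
                linarith
              have := mul_le_mul hwk (hg (k.1 + 1)) (abs_nonneg _) (Real.exp_pos _).le
              have : 0 ≤ J * d (k.1 + 1) := mul_nonneg (Real.exp_pos _).le (hd0 _)
              linarith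
        _ ≤ Real.exp L * M + J * T := by
            rw [Finset.sum_add_distrib, ← Finset.mul_sum, ← Finset.mul_sum]
            exact add_le_add
              (mul_le_mul_of_nonneg_left ((hshift c hc).trans hM) (Real.exp_pos _).le)
              (mul_le_mul_of_nonneg_left ((hshift d hd0).trans hT) (Real.exp_pos _).le))
  have hJpos : 0 < J := Real.exp_pos _
  have hlast := (abs_le_euclNorm (fun k => w k * φ k) (Fin.last n)).trans hbound
  have hwlast : w (Fin.last n) = J := by simp only [hw, hJ, Fin.val_last]
  rw [hwlast, abs_mul, abs_of_pos hJpos] at hlast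
  refine le_of_mul_le_mul_left (hlast.trans ?_) hJpos
  have hexp : Real.exp L = J * Real.exp (L - a * n) := by
    rw [hJ, ← Real.exp_add]
    congr 1
    ring
  rw [hexp]
  calc 2 / κ * (J * Real.exp (L - a * n) * M + J * T + J * T * euclNorm φ)
      ≤ 2 / κ * (J * Real.exp (L - a * n) * M + J * T + J * T * (M / κ)) := by gcongr
    _ = J * (2 / κ * (Real.exp (L - a * n) * M + T * (1 + M / κ))) := by ring

open Matrix Real in
/-- uniform polynomial decay in the lag `j` of the partial autocorrelation
function `ρ_j(t)` defined through the local Yule–Walker equations. -/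
theorem pacf_decay_gamma (τ κ C₀ : ℝ) (hτ : 1 < τ) (hκ : 0 < κ) (hC₀ : 0 < C₀) :
    ∃ C : ℝ, 0 < C ∧
      ∀ (j : ℕ) (hj : 2 ≤ j) (γ : ℝ → ℕ → ℝ)
        (_hbd : ∀ t ∈ Set.Icc (0:ℝ) 1, ∀ r : ℕ, |γ t r| ≤ C₀ * ((r : ℝ) + 1) ^ (-τ))
        (_hmin : ∀ t ∈ Set.Icc (0:ℝ) 1, quadLB (gammaMat γ t j) κ),
        ∀ t ∈ Set.Icc (0:ℝ) 1,
          |((gammaMat γ t j)⁻¹ *ᵥ gammaVec γ t j) ⟨j - 1, by omega⟩| ≤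
            C * ((Real.log j + 1) / j) ^ (τ - 1) := by
  obtain ⟨s, hs, rfl⟩ : ∃ s : ℝ, 0 < s ∧ τ = s + 1 := ⟨τ - 1, by linarith, by ring⟩
  set M : ℝ := 2 * (C₀ * (1 + 1 / s)) with hM
  have hM0 : 0 < M := by positivity
  set L : ℝ := Real.log (1 + κ / (2 * M)) with hLdef
  have hL : 0 < L := Real.log_pos (by linarith [show 0 < κ / (2 * M) by positivity])
  set a : ℝ := 2 * s / L with ha
  have ha0 : 0 < a := by positivity
  refine ⟨2 / κ * (Real.exp L * M + 2 * (C₀ * (a ^ s / s)) * (1 + M / κ)), by positivity, ?_⟩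
  intro j hj γ hbd hmin t ht
  obtain ⟨n, rfl⟩ : ∃ n, j = n + 1 := ⟨j - 1, by omega⟩
  have hn : 1 ≤ n := by omega
  set y : ℝ := ((n + 1 : ℕ) : ℝ) with hy
  have hn1 : (1 : ℝ) ≤ n := by exact_mod_cast hn
  have hyn : y = n + 1 := by rw [hy]; push_cast; rfl
  have hy0 : 0 < y := by linarith
  have hlog : 0 ≤ Real.log y := Real.log_nonneg (by linarith)
  set ℓ : ℝ := Real.log y + 1 with hℓ
  have hℓ0 : 0 < ℓ := by linarith
  have hinv := det_ne_zero_of_quadLB hκ (hmin t ht)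
  have hsolve : gammaMat γ t (n + 1) *ᵥ
      ((gammaMat γ t (n + 1))⁻¹ *ᵥ gammaVec γ t (n + 1)) = fun k => γ t (k.1 + 1) := by
    rw [Matrix.mulVec_mulVec, Matrix.mul_nonsing_inv _ (isUnit_iff_ne_zero.2 hinv),
      Matrix.one_mulVec]
    rfl
  have hβ : 0 < y / (a * ℓ) := by positivity
  have hkey := abs_last_le_of_toeplitz (g := γ t) (M := M) (L := L) (β := y / (a * ℓ))
    (T := 2 * (C₀ * ((y / (a * ℓ)) ^ (-s) / s))) hκ hL.le hβ (hbd t ht)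
    (by
      rw [← Finset.mul_sum]
      have := sum_range_rpow_neg_le hs (n + 2)
      rw [hM]
      gcongr)
    (by
      have := sum_range_ite_rpow_neg_le hs hβ (n + 2)
      simp only [← mul_ite_zero, ← Finset.mul_sum]
      gcongr)
    (by
      rw [hLdef, Real.exp_log (by positivity)]
      apply le_of_eq
      field_simp
      ring)
    (fun k l => rfl) (hmin t ht) hsolve
  have hβpow : (y / (a * ℓ)) ^ (-s) = a ^ s * (ℓ / y) ^ s := by
    rw [Real.rpow_neg hβ.le, ← Real.inv_rpow hβ.le, ← Real.mul_rpow ha0.le (by positivity)]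
    congr 1
    field_simp
  have hexp : Real.exp (L - L / (y / (a * ℓ)) * n) ≤ Real.exp L * (ℓ / y) ^ s := by
    rw [Real.rpow_def_of_pos (by positivity), ← Real.exp_add, Real.exp_le_exp,
      Real.log_div hℓ0.ne' hy0.ne']
    have hrate : L / (y / (a * ℓ)) * n = 2 * s * ℓ * (n / y) := by
      rw [ha]
      field_simp
    have hhalf : 1 / 2 ≤ n / y := by
      rw [div_le_div_iff₀ two_pos hy0]
      linarith
    have hlogℓ : 0 ≤ Real.log ℓ := Real.log_nonneg (by linarith)
    have h1 : 2 * s * ℓ * (1 / 2) ≤ 2 * s * ℓ * (n / y) :=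
      mul_le_mul_of_nonneg_left hhalf (by positivity)
    rw [hrate]
    nlinarith [mul_nonneg hlogℓ hs.le]
  rw [hβpow] at hkey
  rw [add_sub_cancel_right]
  refine hkey.trans ?_
  calc _ ≤ 2 / κ * (Real.exp L * (ℓ / y) ^ s * M +
        2 * (C₀ * (a ^ s * (ℓ / y) ^ s / s)) * (1 + M / κ)) := by gcongr
    _ = _ := by ring
end

section
/- Fix real constants τ > 1, κ > 0 and C₀ > 0. There exists a constant C > 0, depending only on τ, κ and C₀, with the following property: for all integers n ≥ 1 and j ≥ 1, if Γ and Γ̃ are symmetric j×j real matrices with λ_min(Γ) ≥ κ, λ_min(Γ̃) ≥ κ, |Γ_{k,l} − Γ̃_{k,l}| ≤ C₀(|k−l| + 1)/n and |Γ̃_{k,l}| ≤ C₀(|k−l| + 1)^{−τ} for all 1 ≤ k, l ≤ j, and ν, ν̃ ∈ ℝ^j satisfy |ν_k − ν̃_k| ≤ C₀(k + 1)/n and |ν̃_k| ≤ C₀ k^{−τ} for 1 ≤ k ≤ j, then |Γ⁻¹ν − Γ̃⁻¹ν̃| ≤ C j²/n in the Euclidean norm. -/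
open Matrix in
/-- A matrix with a positive quadratic lower bound is bounded below in the Euclidean norm. -/
theorem quadLB.sq_mul_sum_sq_le {j : ℕ} {A : Matrix (Fin j) (Fin j) ℝ} {κ : ℝ}
    (h : quadLB A κ) (hκ : 0 < κ) (v : Fin j → ℝ) :
    κ ^ 2 * ∑ k, v k ^ 2 ≤ ∑ k, (A *ᵥ v) k ^ 2 := by
  have hquad := h v
  have hcs : (v ⬝ᵥ (A *ᵥ v)) ^ 2 ≤ (∑ k, v k ^ 2) * ∑ k, (A *ᵥ v) k ^ 2 :=
    Finset.sum_mul_sq_le_sq_mul_sq _ _ _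
  have ht : 0 ≤ ∑ k, (A *ᵥ v) k ^ 2 := Finset.sum_nonneg fun k _ => sq_nonneg _
  have hs : 0 ≤ ∑ k, v k ^ 2 := Finset.sum_nonneg fun k _ => sq_nonneg _
  rcases hs.eq_or_lt with h0 | hpos
  · rw [← h0, mul_zero]
    exact ht
  · have hsq : (κ * ∑ k, v k ^ 2) ^ 2 ≤ (v ⬝ᵥ (A *ᵥ v)) ^ 2 :=
      pow_le_pow_left₀ (by positivity) hquad 2
    refine le_of_mul_le_mul_left ?_ hpos
    calc (∑ k, v k ^ 2) * (κ ^ 2 * ∑ k, v k ^ 2) = (κ * ∑ k, v k ^ 2) ^ 2 := by ring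
      _ ≤ _ := hsq.trans hcs

open Matrix in
/-- A matrix with a positive quadratic lower bound is invertible. -/
theorem quadLB.isUnit_det {j : ℕ} {A : Matrix (Fin j) (Fin j) ℝ} {κ : ℝ}
    (h : quadLB A κ) (hκ : 0 < κ) : IsUnit A.det := by
  rw [isUnit_iff_ne_zero]
  intro hdet
  obtain ⟨v, hv, hAv⟩ := Matrix.exists_mulVec_eq_zero_iff.mpr hdet
  apply hv
  have hle := h.sq_mul_sum_sq_le hκ v
  simp only [hAv, Pi.zero_apply, ne_eq, OfNat.ofNat_ne_zero, not_false_eq_true, zero_pow,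
    Finset.sum_const_zero] at hle
  have hs : ∑ k, v k ^ 2 = 0 :=
    le_antisymm (nonpos_of_mul_nonpos_right hle (by positivity))
      (Finset.sum_nonneg fun k _ => sq_nonneg _)
  ext k
  exact pow_eq_zero_iff two_ne_zero |>.mp
    ((Finset.sum_eq_zero_iff_of_nonneg fun k _ => sq_nonneg (v k)).mp hs k (Finset.mem_univ k))

open Matrix in
/-- A matrix with a positive quadratic lower bound is a left inverse of its inverse. -/
theorem quadLB.mulVec_inv_mulVec {j : ℕ} {A : Matrix (Fin j) (Fin j) ℝ} {κ : ℝ}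
    (h : quadLB A κ) (hκ : 0 < κ) (v : Fin j → ℝ) : A *ᵥ (A⁻¹ *ᵥ v) = v := by
  rw [mulVec_mulVec, mul_nonsing_inv _ (h.isUnit_det hκ), one_mulVec]

/-- Vectors with entries decaying like `k ^ (-τ)`, `τ > 1`, have square sums bounded uniformly
in the dimension. -/
theorem sum_sq_le_of_abs_le_rpow_neg {τ C₀ : ℝ} (hτ : 1 < τ) {j : ℕ} {v : Fin j → ℝ}
    (hv : ∀ k : Fin j, |v k| ≤ C₀ * ((k.1 : ℝ) + 1) ^ (-τ)) :
    ∑ k, v k ^ 2 ≤ C₀ ^ 2 * ∑' k : ℕ, ((k : ℝ) + 1) ^ (-τ) := by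
  have hsum : Summable fun k : ℕ => ((k : ℝ) + 1) ^ (-τ) := by
    have := (summable_nat_add_iff 1).mpr (Real.summable_nat_rpow.mpr (neg_lt_neg hτ))
    simpa using this
  have hterm : ∀ k : Fin j, v k ^ 2 ≤ C₀ ^ 2 * ((k.1 : ℝ) + 1) ^ (-τ) := fun k => by
    have h0 : 0 ≤ ((k.1 : ℝ) + 1) ^ (-τ) := by positivity
    have h1 : ((k.1 : ℝ) + 1) ^ (-τ) ≤ 1 :=
      Real.rpow_le_one_of_one_le_of_nonpos (by simp) (by linarith)
    calc v k ^ 2 = |v k| ^ 2 := (sq_abs _).symm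
      _ ≤ (C₀ * ((k.1 : ℝ) + 1) ^ (-τ)) ^ 2 := pow_le_pow_left₀ (abs_nonneg _) (hv k) 2
      _ = C₀ ^ 2 * (((k.1 : ℝ) + 1) ^ (-τ)) ^ 2 := mul_pow _ _ _
      _ ≤ _ := by
        gcongr
        exact pow_le_of_le_one h0 h1 two_ne_zero
  calc ∑ k, v k ^ 2 ≤ ∑ k : Fin j, C₀ ^ 2 * ((k.1 : ℝ) + 1) ^ (-τ) :=
        Finset.sum_le_sum fun k _ => hterm k
    _ = C₀ ^ 2 * ∑ k ∈ Finset.range j, ((k : ℝ) + 1) ^ (-τ) := by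
        rw [← Finset.mul_sum, Fin.sum_univ_eq_sum_range (fun k => ((k : ℝ) + 1) ^ (-τ))]
    _ ≤ _ := by
        gcongr
        exact hsum.sum_le_tsum _ fun k _ => by positivity

open Matrix Real in
/-- deterministic perturbation bound for Yule–Walker solutions: if `Γ, ν` are
`O((|k-l|+1)/n)`-close (entrywise) to well-conditioned `Γ̃, ν̃` with polynomially decaying
entries, then `|Γ⁻¹ν - Γ̃⁻¹ν̃| ≤ C j²/n`. -/
theorem yw_perturbation (τ κ C₀ : ℝ) (hτ : 1 < τ) (hκ : 0 < κ) (hC₀ : 0 < C₀) :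
    ∃ C : ℝ, 0 < C ∧
      ∀ (n j : ℕ) (_hn : 1 ≤ n) (_hj : 1 ≤ j)
        (Γ Γt : Matrix (Fin j) (Fin j) ℝ) (ν νt : Fin j → ℝ)
        (_hsym : Γ.IsSymm) (_hsymt : Γt.IsSymm)
        (_hmin : quadLB Γ κ) (_hmint : quadLB Γt κ)
        (_hdiff : ∀ k l : Fin j, |Γ k l - Γt k l| ≤ C₀ * (|(k.1 : ℝ) - (l.1 : ℝ)| + 1) / n)
        (_hΓt : ∀ k l : Fin j, |Γt k l| ≤ C₀ * (|(k.1 : ℝ) - (l.1 : ℝ)| + 1) ^ (-τ))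
        (_hνdiff : ∀ k : Fin j, |ν k - νt k| ≤ C₀ * (((k.1 : ℝ) + 1) + 1) / n)
        (_hνt : ∀ k : Fin j, |νt k| ≤ C₀ * ((k.1 : ℝ) + 1) ^ (-τ)),
        euclNorm (fun k => (Γ⁻¹ *ᵥ ν) k - (Γt⁻¹ *ᵥ νt) k) ≤ C * (j : ℝ) ^ 2 / n := by
  set S : ℝ := ∑' k : ℕ, ((k : ℝ) + 1) ^ (-τ)
  have hS0 : 0 ≤ S := tsum_nonneg fun k => by positivity
  set M : ℝ := C₀ * √S / κ with hM
  have hM0 : 0 ≤ M := by positivity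
  refine ⟨C₀ * (2 + M) / κ, by positivity, ?_⟩
  intro n j hn hj Γ Γt ν νt _ _ hmin hmint hdiff _ hνdiff hνt
  have hn0 : (0 : ℝ) < n := by exact_mod_cast hn
  have hj1 : (1 : ℝ) ≤ j := by exact_mod_cast hj
  set y := Γt⁻¹ *ᵥ νt with hy
  set d : Fin j → ℝ := fun k => (Γ⁻¹ *ᵥ ν) k - y k
  have hΓd : Γ *ᵥ d = (ν - νt) + (Γt - Γ) *ᵥ y := by
    have hdsub : d = Γ⁻¹ *ᵥ ν - y := rfl
    rw [hdsub, mulVec_sub, sub_mulVec, hmin.mulVec_inv_mulVec hκ, hy,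
      hmint.mulVec_inv_mulVec hκ]
    abel
  have hy2 : ∑ k, y k ^ 2 ≤ M ^ 2 := by
    have h1 := hmint.sq_mul_sum_sq_le hκ y
    rw [hy, hmint.mulVec_inv_mulVec hκ, ← hy] at h1
    have h2 := h1.trans (sum_sq_le_of_abs_le_rpow_neg hτ hνt)
    rw [hM, div_pow, mul_pow, Real.sq_sqrt hS0, le_div_iff₀ (by positivity)]
    linarith
  have hy1 : ∑ k, |y k| ≤ √j * M := by
    refine abs_le_of_sq_le_sq' ?_ (by positivity) |>.2
    calc (∑ k, |y k|) ^ 2 ≤ j * ∑ k, |y k| ^ 2 := by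
          simpa using sq_sum_le_card_mul_sum_sq (s := Finset.univ) (f := fun k => |y k|)
      _ = j * ∑ k, y k ^ 2 := by simp only [sq_abs]
      _ ≤ j * M ^ 2 := by gcongr
      _ = (√j * M) ^ 2 := by rw [mul_pow, Real.sq_sqrt (by positivity)]
  have hkj : ∀ k : Fin j, (k.1 : ℝ) + 1 ≤ j := fun k => by exact_mod_cast k.2
  have hentry : ∀ k, |(Γ *ᵥ d) k| ≤ C₀ * (2 + M) * (j * √j) / n := fun k => by
    have hmat : |((Γt - Γ) *ᵥ y) k| ≤ C₀ * j / n * (√j * M) := by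
      calc |((Γt - Γ) *ᵥ y) k| ≤ ∑ l, |(Γt - Γ) k l * y l| := by
            simp only [mulVec, dotProduct]
            exact Finset.abs_sum_le_sum_abs _ _
        _ ≤ ∑ l, C₀ * j / n * |y l| := by
            refine Finset.sum_le_sum fun l _ => ?_
            rw [abs_mul, Matrix.sub_apply, abs_sub_comm]
            refine mul_le_mul_of_nonneg_right ((hdiff k l).trans ?_) (abs_nonneg _)
            have hkl : |(k.1 : ℝ) - (l.1 : ℝ)| + 1 ≤ j := by
              have : |(k.1 : ℝ) - (l.1 : ℝ)| ≤ j - 1 :=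
                abs_le.mpr ⟨by linarith [hkj l, Nat.cast_nonneg (α := ℝ) k.1],
                  by linarith [hkj k, Nat.cast_nonneg (α := ℝ) l.1]⟩
              linarith
            gcongr
        _ = C₀ * j / n * ∑ l, |y l| := (Finset.mul_sum _ _ _).symm
        _ ≤ _ := by gcongr
    have hvec : |ν k - νt k| ≤ C₀ * (2 * (j * √j)) / n := by
      refine (hνdiff k).trans ?_
      have hsj : 1 ≤ √(j : ℝ) := Real.one_le_sqrt.mpr hj1
      have : (k.1 : ℝ) + 1 + 1 ≤ 2 * (j * √j) := by nlinarith [hkj k]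
      gcongr
    rw [hΓd]
    calc |(ν - νt + (Γt - Γ) *ᵥ y) k| ≤ |ν k - νt k| + |((Γt - Γ) *ᵥ y) k| := abs_add_le _ _
      _ ≤ C₀ * (2 * (j * √j)) / n + C₀ * j / n * (√j * M) := add_le_add hvec hmat
      _ = _ := by ring
  have hnorm : κ ^ 2 * ∑ k, d k ^ 2 ≤ (C₀ * (2 + M) * j ^ 2 / n) ^ 2 := by
    calc κ ^ 2 * ∑ k, d k ^ 2 ≤ ∑ k, (Γ *ᵥ d) k ^ 2 := hmin.sq_mul_sum_sq_le hκ d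
      _ ≤ ∑ _k : Fin j, (C₀ * (2 + M) * (j * √j) / n) ^ 2 :=
          Finset.sum_le_sum fun k _ => by
            rw [← sq_abs]
            exact pow_le_pow_left₀ (abs_nonneg _) (hentry k) 2
      _ = j * (√j) ^ 2 * (C₀ * (2 + M) * j / n) ^ 2 := by
          rw [Finset.sum_const, Finset.card_univ, Fintype.card_fin, nsmul_eq_mul]
          ring
      _ = _ := by
          rw [Real.sq_sqrt (by positivity)]
          ring
  refine Real.sqrt_le_iff.mpr ⟨by positivity, ?_⟩
  refine le_of_mul_le_mul_left (hnorm.trans_eq ?_) (pow_pos hκ 2)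
  field_simp
end

section
/- Fix real constants τ > 1, κ > 0, Λ > 0 and C₀ > 0. There exist constants K₀ ≥ 1 and C > 0, depending only on τ, κ, Λ and C₀, with the following property: for every integer j ≥ 2 and every integer b with 1 ≤ b ≤ j/(K₀(log j + 1)), if B is a symmetric j×j real matrix with B_{k,l} = 0 whenever |k−l| > b, λ_min(B) ≥ κ and ‖B‖ ≤ Λ, and ν ∈ ℝ^j satisfies |ν_k| ≤ C₀ k^{−τ} for 1 ≤ k ≤ j, then the last coordinate of B⁻¹ν satisfies |(B⁻¹ν)_j| ≤ C((log j + 1)/j)^{τ−1}. -/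
open Matrix in
lemma dotProduct_mulVec_self_le_of_opNorm_le {j : ℕ} {B : Matrix (Fin j) (Fin j) ℝ} {Λ : ℝ}
    (h : opNorm B ≤ Λ) (v : Fin j → ℝ) :
    (B *ᵥ v) ⬝ᵥ (B *ᵥ v) ≤ Λ ^ 2 * (v ⬝ᵥ v) := by
  have h1 := (Matrix.toEuclideanCLM (𝕜 := ℝ) B).le_of_opNorm_le h (WithLp.toLp 2 v)
  have h2 := pow_le_pow_left₀ (norm_nonneg _) h1 2
  rw [mul_pow, EuclideanSpace.norm_sq_eq, EuclideanSpace.norm_sq_eq] at h2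
  simpa [dotProduct, ← sq] using h2

open Matrix in
lemma quadLB.dotProduct_le {j : ℕ} {B : Matrix (Fin j) (Fin j) ℝ} {κ : ℝ}
    (h : quadLB B κ) (v : Fin j → ℝ) : κ * (v ⬝ᵥ v) ≤ v ⬝ᵥ (B *ᵥ v) := by
  simpa [dotProduct, ← sq] using h v

open Matrix in
lemma quadLB.sq_mul_dotProduct_self_le {j : ℕ} {B : Matrix (Fin j) (Fin j) ℝ} {κ : ℝ}
    (hκ : 0 < κ) (h : quadLB B κ) (v : Fin j → ℝ) :
    κ ^ 2 * (v ⬝ᵥ v) ≤ (B *ᵥ v) ⬝ᵥ (B *ᵥ v) := by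
  have h1 := h.dotProduct_le v
  have h2 : 0 ≤ (B *ᵥ v - κ • v) ⬝ᵥ (B *ᵥ v - κ • v) := by
    simpa using dotProduct_self_star_nonneg (B *ᵥ v - κ • v)
  simp only [sub_dotProduct, dotProduct_sub, smul_dotProduct, dotProduct_smul, smul_eq_mul,
    dotProduct_comm (B *ᵥ v) v] at h2
  nlinarith

open Matrix in
lemma quadLB.isUnit {j : ℕ} {B : Matrix (Fin j) (Fin j) ℝ} {κ : ℝ}
    (hκ : 0 < κ) (h : quadLB B κ) : IsUnit B := by
  rw [← Matrix.mulVec_injective_iff_isUnit]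
  refine (injective_iff_map_eq_zero (Matrix.mulVecLin B)).2 fun v hv => ?_
  have h1 := h.dotProduct_le v
  rw [show B *ᵥ v = 0 from hv, dotProduct_zero] at h1
  have h2 : 0 ≤ v ⬝ᵥ v := by simpa using dotProduct_self_star_nonneg v
  exact dotProduct_self_eq_zero.1 (by nlinarith)

open Matrix in
/-- One Richardson step with step size `κ / M ^ 2` contracts the squared Euclidean norm. -/
lemma richardson_contraction {j : ℕ} {B : Matrix (Fin j) (Fin j) ℝ} {κ Λ M : ℝ}
    (hκ : 0 < κ) (hΛ : 0 < Λ) (hM : Λ ≤ M) (hmin : quadLB B κ) (hop : opNorm B ≤ Λ)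
    (v : Fin j → ℝ) :
    (v - (κ / M ^ 2) • (B *ᵥ v)) ⬝ᵥ (v - (κ / M ^ 2) • (B *ᵥ v)) ≤
      (1 - κ ^ 2 / M ^ 2) * (v ⬝ᵥ v) := by
  have h1 := hmin.dotProduct_le v
  have h0 : 0 ≤ v ⬝ᵥ v := by simpa using dotProduct_self_star_nonneg v
  have h2 : (B *ᵥ v) ⬝ᵥ (B *ᵥ v) ≤ M ^ 2 * (v ⬝ᵥ v) :=
    (dotProduct_mulVec_self_le_of_opNorm_le hop v).trans (by gcongr)
  have hM0 : 0 < M := hΛ.trans_le hM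
  have ht : 0 < κ / M ^ 2 := by positivity
  have e : κ ^ 2 / M ^ 2 = κ * (κ / M ^ 2) := by ring
  have e2 : κ / M ^ 2 * M ^ 2 = κ := by field_simp
  rw [e]
  generalize κ / M ^ 2 = t at *
  simp only [sub_dotProduct, dotProduct_sub, smul_dotProduct, dotProduct_smul, smul_eq_mul,
    dotProduct_comm (B *ᵥ v) v]
  have h3 := mul_le_mul_of_nonneg_left h1 ht.le
  have h4 := mul_le_mul_of_nonneg_left h2 (mul_nonneg ht.le ht.le)
  have e3 : t * t * (M ^ 2 * (v ⬝ᵥ v)) = t * κ * (v ⬝ᵥ v) := by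
    rw [← e2]; ring
  linarith

open Matrix in
/-- Solutions of a well-conditioned banded system are approximated exponentially fast by vectors
whose support grows linearly. -/
lemma exists_banded_approximation {j b m : ℕ} {B : Matrix (Fin j) (Fin j) ℝ} {κ Λ M : ℝ}
    (hκ : 0 < κ) (hΛ : 0 < Λ) (hM : Λ ≤ M) (hq : 0 ≤ 1 - κ ^ 2 / M ^ 2)
    (hband : ∀ k l : Fin j, (b : ℤ) < |(k.1 : ℤ) - (l.1 : ℤ)| → B k l = 0)
    (hmin : quadLB B κ) (hop : opNorm B ≤ Λ) (x : Fin j → ℝ)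
    (hx : ∀ k : Fin j, m ≤ k.1 → (B *ᵥ x) k = 0) (n : ℕ) :
    ∃ y : Fin j → ℝ, (∀ k : Fin j, m + n * b ≤ k.1 → y k = 0) ∧
      (x - y) ⬝ᵥ (x - y) ≤ (1 - κ ^ 2 / M ^ 2) ^ n * (x ⬝ᵥ x) := by
  induction n with
  | zero => exact ⟨0, by simp, by simp⟩
  | succ n ih =>
    obtain ⟨y, hy, hxy⟩ := ih
    refine ⟨y + (κ / M ^ 2) • (B *ᵥ x - B *ᵥ y), fun k hk => ?_, ?_⟩
    · have hk' : m + n * b + b ≤ k.1 := by linarith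
      have hBy : (B *ᵥ y) k = 0 := by
        show ∑ l, B k l * y l = 0
        refine Finset.sum_eq_zero fun l _ => ?_
        by_cases hl : m + n * b ≤ l.1
        · rw [hy l hl, mul_zero]
        · rw [hband k l (by rw [lt_abs]; omega), zero_mul]
      simp [hy k (by omega), hBy, hx k (by nlinarith [Nat.zero_le (n * b)])]
    · have e : x - (y + (κ / M ^ 2) • (B *ᵥ x - B *ᵥ y)) =
          (x - y) - (κ / M ^ 2) • (B *ᵥ (x - y)) := by
        rw [mulVec_sub]; abel
      rw [e]
      calc _ ≤ _ := richardson_contraction hκ hΛ hM hmin hop (x - y)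
        _ ≤ _ := mul_le_mul_of_nonneg_left hxy hq
        _ = _ := by ring

open Matrix in
lemma sq_apply_le_dotProduct_self {j : ℕ} (v : Fin j → ℝ) (k : Fin j) :
    v k ^ 2 ≤ v ⬝ᵥ v := by
  simpa [dotProduct, ← sq] using
    Finset.single_le_sum (f := fun i => v i ^ 2) (fun i _ => sq_nonneg _) (Finset.mem_univ k)

open Matrix in
lemma dotProduct_self_le_of_abs_le {j : ℕ} {v : Fin j → ℝ} {c : ℝ}
    (h : ∀ k, |v k| ≤ c) : v ⬝ᵥ v ≤ j * c ^ 2 := by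
  have : v ⬝ᵥ v ≤ ∑ _k : Fin j, c ^ 2 := by
    refine Finset.sum_le_sum fun k _ => ?_
    rw [← sq, ← sq_abs]
    exact pow_le_pow_left₀ (abs_nonneg _) (h k) 2
  simpa using this

/-- A geometric factor over at least `K / 2 * (log j + 1) - 2` steps beats the power `j ^ (-s)`
once `K` is large. -/
lemma pow_le_rpow_neg_of_log_le {q K s J : ℝ} {N : ℕ} (hq0 : 0 < q) (hq1 : q < 1) (hs : 0 ≤ s)
    (hJ : 1 ≤ J) (hK : 2 * s / (-Real.log q) ≤ K) (hN : K * (Real.log J + 1) / 2 - 2 ≤ N) :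
    q ^ N ≤ (q ^ 2)⁻¹ * J ^ (-s) := by
  have hlq : 0 < -Real.log q := neg_pos.2 (Real.log_neg hq0 hq1)
  have hlJ : 0 ≤ Real.log J := Real.log_nonneg hJ
  rw [div_le_iff₀ hlq] at hK
  have hsplit : (q ^ 2)⁻¹ = Real.exp (-2 * Real.log q) := by
    rw [show -2 * Real.log q = -((2 : ℕ) * Real.log q) by push_cast; ring, Real.exp_neg,
      Real.exp_nat_mul, Real.exp_log hq0]
  have hpow : q ^ N = Real.exp (N * Real.log q) := by
    rw [Real.exp_nat_mul, Real.exp_log hq0]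
  rw [hsplit, hpow, Real.rpow_def_of_pos (by linarith), ← Real.exp_add, Real.exp_le_exp]
  have h1 := mul_le_mul_of_nonneg_right hN hlq.le
  have h2 := mul_le_mul_of_nonneg_right hK (by linarith : 0 ≤ Real.log J + 1)
  nlinarith

open Matrix Real in
/-- banded-system step of the PACF decay bound: for a well-conditioned
symmetric banded matrix `B` of bandwidth `b ≤ j/(K₀(log j + 1))` and a polynomially
decaying vector `ν`, the last coordinate of `B⁻¹ν` is `O(((log j + 1)/j)^(τ-1))`. -/
theorem banded_inverse_last (τ κ Λ C₀ : ℝ) (hτ : 1 < τ) (hκ : 0 < κ) (hΛ : 0 < Λ)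
    (hC₀ : 0 < C₀) :
    ∃ K₀ C : ℝ, 1 ≤ K₀ ∧ 0 < C ∧
      ∀ (j b : ℕ) (hj : 2 ≤ j) (_hb1 : 1 ≤ b)
        (_hb2 : (b : ℝ) ≤ (j : ℝ) / (K₀ * (Real.log j + 1)))
        (B : Matrix (Fin j) (Fin j) ℝ) (_hsym : B.IsSymm)
        (_hband : ∀ k l : Fin j, (b : ℤ) < |(k.1 : ℤ) - (l.1 : ℤ)| → B k l = 0)
        (_hmin : quadLB B κ) (_hop : opNorm B ≤ Λ)
        (ν : Fin j → ℝ) (_hν : ∀ k : Fin j, |ν k| ≤ C₀ * ((k.1 : ℝ) + 1) ^ (-τ)),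
        |(B⁻¹ *ᵥ ν) ⟨j - 1, by omega⟩| ≤ C * ((Real.log j + 1) / j) ^ (τ - 1) := by
  set M : ℝ := Λ + κ with hMdef
  have hM : Λ ≤ M := by linarith
  have hM0 : 0 < M := by linarith
  set q : ℝ := 1 - κ ^ 2 / M ^ 2 with hq
  have hq0 : 0 < q := by
    rw [hq, sub_pos, div_lt_one (by positivity)]
    exact pow_lt_pow_left₀ (by linarith) hκ.le two_ne_zero
  have hq1 : q < 1 := by
    have : 0 < κ ^ 2 / M ^ 2 := by positivity
    linarith
  refine ⟨max 1 (2 * (2 * τ - 1) / (-Real.log q)), κ⁻¹ * C₀ * (q⁻¹ + 2 ^ τ), le_max_left _ _,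
    by positivity, ?_⟩
  set K := max 1 (2 * (2 * τ - 1) / (-Real.log q)) with hK
  intro j b hj hb1 hb2 B _ hband hmin hop ν hν
  have hK1 : 1 ≤ K := le_max_left _ _
  have hJ2 : (2 : ℝ) ≤ j := by exact_mod_cast hj
  have hJ0 : (0 : ℝ) < j := by linarith
  have hlog : 0 ≤ Real.log j := Real.log_nonneg (by linarith)
  have hbR : (1 : ℝ) ≤ b := by exact_mod_cast hb1
  have hdet : IsUnit B.det := (Matrix.isUnit_iff_isUnit_det B).1 (hmin.isUnit hκ)
  have hBinv : ∀ u : Fin j → ℝ, B *ᵥ (B⁻¹ *ᵥ u) = u := fun u => by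
    rw [mulVec_mulVec, mul_nonsing_inv _ hdet, one_mulVec]
  set N : ℕ := (j - 1 - j / 2) / b with hNdef
  have hNb : j / 2 + N * b ≤ j - 1 := by
    have := Nat.div_mul_le_self (j - 1 - j / 2) b
    rw [← hNdef] at this
    omega
  have hN : K * (Real.log j + 1) / 2 - 2 ≤ N := by
    have h1 : j - 1 - j / 2 < b * (N + 1) := Nat.lt_mul_div_succ _ hb1
    have h2 : j ≤ 2 * (b * (N + 1)) + 2 := by omega
    have h3 : (j : ℝ) ≤ 2 * (b * (N + 1)) + 2 := by exact_mod_cast h2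
    rw [le_div_iff₀ (by positivity)] at hb2
    nlinarith
  set ν₁ : Fin j → ℝ := fun k => if k.1 < j / 2 then ν k else 0 with hν₁
  set ν₂ : Fin j → ℝ := fun k => if k.1 < j / 2 then 0 else ν k with hν₂
  have hsplit : ν = ν₁ + ν₂ := by
    ext k
    simp only [hν₁, hν₂, Pi.add_apply]
    split_ifs <;> simp
  set last : Fin j := ⟨j - 1, by omega⟩ with hlast
  set D : ℝ := (j : ℝ) ^ (-(τ - 1)) with hD
  have hD0 : 0 < D := by positivity
  have hDsq : D ^ 2 = (j : ℝ) ^ (-(2 * τ - 2)) := by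
    rw [hD, ← Real.rpow_natCast, ← Real.rpow_mul hJ0.le]
    congr 1
    push_cast
    ring
  have hnear : |(B⁻¹ *ᵥ ν₁) last| ≤ κ⁻¹ * C₀ * q⁻¹ * D := by
    obtain ⟨y, hy, hxy⟩ := exists_banded_approximation (m := j / 2) hκ hΛ hM hq0.le hband hmin hop
      (B⁻¹ *ᵥ ν₁) (fun k hk => by rw [hBinv]; simp [hν₁, hk]) N
    have h1 := sq_apply_le_dotProduct_self (B⁻¹ *ᵥ ν₁ - y) last
    rw [Pi.sub_apply, hy last hNb, sub_zero] at h1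
    have h2 := hmin.sq_mul_dotProduct_self_le hκ (B⁻¹ *ᵥ ν₁)
    rw [hBinv] at h2
    have h3 : ν₁ ⬝ᵥ ν₁ ≤ j * C₀ ^ 2 := by
      refine dotProduct_self_le_of_abs_le fun k => ?_
      simp only [hν₁]
      split_ifs
      · refine (hν k).trans (mul_le_of_le_one_right hC₀.le ?_)
        exact Real.rpow_le_one_of_one_le_of_nonpos (by simp) (by linarith)
      · simpa using hC₀.le
    have h4 : q ^ N ≤ (q ^ 2)⁻¹ * (j : ℝ) ^ (-(2 * τ - 1)) :=
      pow_le_rpow_neg_of_log_le hq0 hq1 (by linarith) (by linarith) (le_max_right _ _) hN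
    have h5 : (j : ℝ) ^ (-(2 * τ - 1)) * j = D ^ 2 := by
      rw [hDsq, ← Real.rpow_add_one hJ0.ne']
      congr 1
      ring
    have h6 : (B⁻¹ *ᵥ ν₁) ⬝ᵥ (B⁻¹ *ᵥ ν₁) ≤ (κ ^ 2)⁻¹ * (j * C₀ ^ 2) := by
      rw [inv_mul_eq_div, le_div_iff₀ (by positivity)]
      linarith
    refine abs_le_of_sq_le_sq ?_ (by positivity)
    calc _ ≤ _ := h1.trans hxy
      _ ≤ ((q ^ 2)⁻¹ * (j : ℝ) ^ (-(2 * τ - 1))) * ((κ ^ 2)⁻¹ * (j * C₀ ^ 2)) := by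
        gcongr
        simpa using dotProduct_self_star_nonneg (B⁻¹ *ᵥ ν₁)
      _ = (κ⁻¹ * C₀ * q⁻¹) ^ 2 * ((j : ℝ) ^ (-(2 * τ - 1)) * j) := by
        simp only [mul_pow, inv_pow]
        ring
      _ = _ := by rw [h5]; ring
  have hfar : |(B⁻¹ *ᵥ ν₂) last| ≤ κ⁻¹ * C₀ * 2 ^ τ * D := by
    have h1 := sq_apply_le_dotProduct_self (B⁻¹ *ᵥ ν₂) last
    have h2 := hmin.sq_mul_dotProduct_self_le hκ (B⁻¹ *ᵥ ν₂)
    rw [hBinv] at h2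
    have h3 : ν₂ ⬝ᵥ ν₂ ≤ j * (C₀ * ((j : ℝ) / 2) ^ (-τ)) ^ 2 := by
      refine dotProduct_self_le_of_abs_le fun k => ?_
      simp only [hν₂]
      split_ifs with hk
      · simp only [abs_zero]
        positivity
      · refine (hν k).trans (mul_le_mul_of_nonneg_left ?_ hC₀.le)
        refine Real.rpow_le_rpow_of_nonpos (by positivity) ?_ (by linarith)
        have : j ≤ 2 * (k.1 + 1) := by omega
        have : (j : ℝ) ≤ 2 * (k.1 + 1) := by exact_mod_cast this
        linarith
    have h4 : ((j : ℝ) / 2) ^ (-τ) = 2 ^ τ * (j : ℝ) ^ (-τ) := by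
      rw [Real.div_rpow hJ0.le two_pos.le, Real.rpow_neg two_pos.le, div_inv_eq_mul, mul_comm]
    have h5 : j * ((j : ℝ) ^ (-τ)) ^ 2 ≤ D ^ 2 := by
      have e : j * ((j : ℝ) ^ (-τ)) ^ 2 = (j : ℝ) ^ (1 - 2 * τ) := by
        rw [← Real.rpow_natCast, ← Real.rpow_mul hJ0.le, mul_comm, ← Real.rpow_add_one hJ0.ne']
        congr 1
        push_cast
        ring
      rw [e, hDsq]
      exact Real.rpow_le_rpow_of_exponent_le (by linarith) (by linarith)
    refine abs_le_of_sq_le_sq (h1.trans ?_) (by positivity)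
    rw [← mul_le_mul_iff_right₀ (by positivity : 0 < κ ^ 2)]
    calc _ ≤ _ := h2.trans h3
      _ = (C₀ * 2 ^ τ) ^ 2 * (j * ((j : ℝ) ^ (-τ)) ^ 2) := by rw [h4]; ring
      _ ≤ (C₀ * 2 ^ τ) ^ 2 * D ^ 2 := by gcongr
      _ = _ := by field_simp
  have hDle : D ≤ ((Real.log j + 1) / j) ^ (τ - 1) := by
    rw [hD, Real.rpow_neg hJ0.le, ← Real.inv_rpow hJ0.le]
    refine Real.rpow_le_rpow (by positivity) ?_ (by linarith)
    rw [inv_eq_one_div]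
    gcongr
    linarith
  calc |(B⁻¹ *ᵥ ν) last| = |(B⁻¹ *ᵥ ν₁) last + (B⁻¹ *ᵥ ν₂) last| := by
        rw [hsplit, mulVec_add, Pi.add_apply]
    _ ≤ _ := abs_add_le _ _
    _ ≤ _ := add_le_add hnear hfar
    _ = κ⁻¹ * C₀ * (q⁻¹ + 2 ^ τ) * D := by ring
    _ ≤ _ := mul_le_mul_of_nonneg_left hDle (by positivity)
end
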